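/- Let F : ℝ × ℝ → ℝ be a Borel measurable, locally bounded function satisfying both equation (A) and equation (B) with weight ω, define Ẑ(x,y) := 1 + ∫_y^x ω(z) F(z,y) dz, and let q ≥ 0 with W^{(q)} as in the context. Then for all x ≥ c one has q ∫_c^x (Ẑ(x,y) − 1) W^{(q)}(y−c) dy = ∫_c^x Ẑ(x,u) ω(u) (W^{(q)}(u−c) − W(u−c)) du. -/

import Mathlib

open MeasureTheory Set

noncomputable section

/-- A real-valued function is locally bounded if it is bounded on every compact set. -/
def LocBdd {α : Type*} [TopologicalSpace α] (f : α → ℝ) : Prop :=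
  ∀ K : Set α, IsCompact K → ∃ C : ℝ, ∀ x ∈ K, |f x| ≤ C

namespace LocBdd

variable {α β : Type*} [TopologicalSpace α] [TopologicalSpace β] {f g : α → ℝ}

lemma mul (hf : LocBdd f) (hg : LocBdd g) : LocBdd fun x => f x * g x := by
  intro K hK
  obtain ⟨C, hC⟩ := hf K hK
  obtain ⟨D, hD⟩ := hg K hK
  refine ⟨C * D, fun x hx => ?_⟩
  rw [abs_mul]
  exact mul_le_mul (hC x hx) (hD x hx) (abs_nonneg _) ((abs_nonneg _).trans (hC x hx))

lemma const_add (c : ℝ) (hf : LocBdd f) : LocBdd fun x => c + f x := by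
  intro K hK
  obtain ⟨C, hC⟩ := hf K hK
  exact ⟨|c| + C, fun x hx => (abs_add_le _ _).trans (by gcongr; exact hC x hx)⟩

lemma comp (hf : LocBdd f) {φ : β → α} (hφ : Continuous φ) : LocBdd fun x => f (φ x) := by
  intro K hK
  obtain ⟨C, hC⟩ := hf (φ '' K) (hK.image hφ)
  exact ⟨C, fun x hx => hC _ (mem_image_of_mem φ hx)⟩

lemma integrableOn [MeasurableSpace α] {μ : Measure α} [IsFiniteMeasureOnCompacts μ] (hf : LocBdd f) (hm : Measurable f)
    {K : Set α} (hK : IsCompact K) (hKm : MeasurableSet K) : IntegrableOn f K μ := by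
  obtain ⟨C, hC⟩ := hf K hK
  exact Measure.integrableOn_of_bounded hK.measure_lt_top.ne hm.aestronglyMeasurable
    ((ae_restrict_iff' hKm).2 (.of_forall hC))

lemma intervalIntegrable {h : ℝ → ℝ} (hh : LocBdd h) (hm : Measurable h) (a b : ℝ) :
    IntervalIntegrable h volume a b :=
  (hh.integrableOn hm isCompact_uIcc measurableSet_uIcc).intervalIntegrable

lemma intervalIntegral_left {f : ℝ × ℝ → ℝ} (hf : LocBdd f) (b : ℝ) :
    LocBdd fun u => ∫ z in u..b, f (z, u) := by
  intro K hK
  obtain ⟨r, hr⟩ := hK.isBounded.subset_closedBall b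
  obtain ⟨C, hC⟩ := hf (Metric.closedBall b r ×ˢ Metric.closedBall b r)
    ((isCompact_closedBall b r).prod (isCompact_closedBall b r))
  refine ⟨C * r, fun u hu => ?_⟩
  have hur := hr hu
  have hdist : |b - u| ≤ r := by
    rw [abs_sub_comm]
    exact hur
  have hr0 : 0 ≤ r := (abs_nonneg _).trans hdist
  have hbr : b ∈ Metric.closedBall b r := Metric.mem_closedBall_self hr0
  have hC0 : 0 ≤ C := (abs_nonneg _).trans (hC (b, b) ⟨hbr, hbr⟩)
  have hbound : ∀ z ∈ uIoc u b, ‖f (z, u)‖ ≤ C := by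
    intro z hz
    refine hC (z, u) ⟨?_, hur⟩
    rw [Real.closedBall_eq_Icc] at hur hbr ⊢
    exact uIcc_subset_Icc hur hbr (uIoc_subset_uIcc hz)
  exact (intervalIntegral.norm_integral_le_of_norm_le_const hbound).trans
    (mul_le_mul_of_nonneg_left hdist hC0)

end LocBdd

lemma measurable_intervalIntegral_left {f : ℝ × ℝ → ℝ} (hf : Measurable f) (b : ℝ) :
    Measurable fun u => ∫ z in u..b, f (z, u) := by
  have key : ∀ S : Set (ℝ × ℝ), MeasurableSet S →
      Measurable fun u => ∫ z, S.indicator f (z, u) := fun S hS =>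
    (StronglyMeasurable.integral_prod_left (μ := volume)
      (f := fun z u => S.indicator f (z, u)) (hf.indicator hS).stronglyMeasurable).measurable
  have h1 := key {p | p.2 < p.1 ∧ p.1 ≤ b} ((measurableSet_lt measurable_snd measurable_fst).inter
    (measurableSet_le measurable_fst measurable_const))
  have h2 := key {p | b < p.1 ∧ p.1 ≤ p.2} ((measurableSet_lt measurable_const measurable_fst).inter
    (measurableSet_le measurable_fst measurable_snd))
  convert h1.sub h2 using 1
  funext u
  simp only [intervalIntegral, Pi.sub_apply]
  rw [← integral_indicator measurableSet_Ioc, ← integral_indicator measurableSet_Ioc]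
  rfl

lemma intervalIntegral_integral_triangle_swap {f : ℝ × ℝ → ℝ} (hm : Measurable f) (hf : LocBdd f)
    {a b : ℝ} (hab : a ≤ b) :
    ∫ u in a..b, ∫ y in a..u, f (u, y) = ∫ y in a..b, ∫ u in y..b, f (u, y) := by
  set T : Set (ℝ × ℝ) := {p | p.2 ≤ p.1}
  have hT : MeasurableSet T := measurableSet_le measurable_snd measurable_fst
  have hint : Integrable (T.indicator f)
      ((volume.restrict (Ioc a b)).prod (volume.restrict (Ioc a b))) := by
    rw [Measure.prod_restrict]
    exact ((hf.integrableOn hm (isCompact_Icc.prod isCompact_Icc)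
      (measurableSet_Icc.prod measurableSet_Icc)).mono_set
        (prod_mono Ioc_subset_Icc_self Ioc_subset_Icc_self)).indicator hT
  have hswap := integral_integral_swap (f := fun u y => T.indicator f (u, y)) hint
  rw [intervalIntegral.integral_of_le hab, intervalIntegral.integral_of_le hab]
  refine Eq.trans (setIntegral_congr_fun measurableSet_Ioc fun u hu => ?_)
    (hswap.trans (setIntegral_congr_fun measurableSet_Ioc fun y hy => ?_))
  · have : (fun y => T.indicator f (u, y)) = (Iic u).indicator fun y => f (u, y) := rfl
    simp only [this]
    rw [setIntegral_indicator measurableSet_Iic, intervalIntegral.integral_of_le hu.1.le,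
      Ioc_inter_Iic, min_eq_right hu.2]
  · have : (fun u => T.indicator f (u, y)) = (Ici y).indicator fun u => f (u, y) := rfl
    simp only [this]
    have hset : Ioc a b ∩ Ici y = Icc y b := by
      ext u
      simp only [mem_inter_iff, mem_Ioc, mem_Ici, mem_Icc]
      exact ⟨fun h => ⟨h.2, h.1.2⟩, fun h => ⟨⟨hy.1.trans_le h.1, h.2⟩, h.1⟩⟩
    rw [setIntegral_indicator measurableSet_Ici, hset, intervalIntegral.integral_of_le hy.2,
      integral_Icc_eq_integral_Ioc]

/-- A resolvent equation in the second variable, integrated over the first variable. -/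
lemma integral_one_add_mul_kernel {W ω : ℝ → ℝ} (hWm : Measurable W) (hW : LocBdd W)
    (hωm : Measurable ω) (hω : LocBdd ω) {F : ℝ × ℝ → ℝ} (hFm : Measurable F) (hF : LocBdd F)
    (hFB : ∀ x y : ℝ, F (x, y) = W (x - y) + ∫ z in y..x, F (x, z) * ω z * W (z - y))
    {x y : ℝ} (hyx : y ≤ x) :
    ∫ u in y..x, (1 + ∫ z in u..x, ω z * F (z, u)) * ω u * W (u - y)
      = ∫ z in y..x, ω z * F (z, y) := by
  have hωF : LocBdd fun p : ℝ × ℝ => ω p.1 * F p := (hω.comp continuous_fst).mul hF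
  have hωFm : Measurable fun p : ℝ × ℝ => ω p.1 * F p := by fun_prop
  have hk : LocBdd fun u => ω u * W (u - y) := hω.mul (hW.comp (by fun_prop))
  have hkm : Measurable fun u => ω u * W (u - y) := by fun_prop
  have hZ := hωF.intervalIntegral_left x
  have hZm := measurable_intervalIntegral_left hωFm x
  have hsplit : ∫ u in y..x, (1 + ∫ z in u..x, ω z * F (z, u)) * ω u * W (u - y)
      = (∫ u in y..x, ω u * W (u - y))
        + ∫ u in y..x, ∫ z in u..x, ω z * F (z, u) * (ω u * W (u - y)) := by
    simp_rw [intervalIntegral.integral_mul_const]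
    rw [← intervalIntegral.integral_add (hk.intervalIntegrable hkm _ _)
      ((hZ.mul hk).intervalIntegrable (hZm.mul hkm) _ _)]
    congr 1
    ext u
    ring
  have hswap := intervalIntegral_integral_triangle_swap
    (f := fun p : ℝ × ℝ => ω p.1 * F p * (ω p.2 * W (p.2 - y)))
    (hωFm.mul (hkm.comp measurable_snd)) (hωF.mul (hk.comp continuous_snd)) hyx
  have hinner : ∀ z, ∫ u in y..z, ω z * F (z, u) * (ω u * W (u - y))
      = ω z * F (z, y) - ω z * W (z - y) := by
    intro z
    rw [hFB z y, mul_add, add_sub_cancel_left, ← intervalIntegral.integral_const_mul]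
    congr 1
    ext u
    ring
  have hωFy : LocBdd fun z => ω z * F (z, y) := hω.mul (hF.comp (by fun_prop))
  rw [hsplit, ← hswap]
  simp_rw [hinner]
  rw [intervalIntegral.integral_sub (hωFy.intervalIntegrable (by fun_prop) _ _)
    (hk.intervalIntegrable hkm _ _)]
  ring

/-- Identity (3.2) of the paper:
`q ∫_c^x (Ẑ(x,y) - 1) W^{(q)}(y-c) dy = ∫_c^x Ẑ(x,u) ω(u) (W^{(q)}(u-c) - W(u-c)) du`. -/
theorem statement5
    (W ω : ℝ → ℝ)
    (hWmeas : Measurable W) (hWbdd : LocBdd W) (hWneg : ∀ x : ℝ, x < 0 → W x = 0)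
    (hωmeas : Measurable ω) (hωbdd : LocBdd ω) (hωpos : ∀ x : ℝ, 0 ≤ ω x)
    (F : ℝ × ℝ → ℝ) (hFmeas : Measurable F) (hFbdd : LocBdd F)
    (hFA : ∀ x y : ℝ, F (x, y) = W (x - y) + ∫ z in y..x, W (x - z) * ω z * F (z, y))
    (hFB : ∀ x y : ℝ, F (x, y) = W (x - y) + ∫ z in y..x, F (x, z) * ω z * W (z - y))
    (Zh : ℝ → ℝ → ℝ)
    (hZh : ∀ x y : ℝ, Zh x y = 1 + ∫ z in y..x, ω z * F (z, y))
    (q : ℝ) (hq : 0 ≤ q)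
    (Wq : ℝ → ℝ)
    (hWqmeas : Measurable Wq) (hWqbdd : LocBdd Wq) (hWqneg : ∀ x : ℝ, x < 0 → Wq x = 0)
    (hWqeq : ∀ x : ℝ, Wq x = W x + q * ∫ z in (0 : ℝ)..x, W (x - z) * Wq z) :
    ∀ x c : ℝ, c ≤ x →
      q * ∫ y in c..x, (Zh x y - 1) * Wq (y - c)
        = ∫ u in c..x, Zh x u * ω u * (Wq (u - c) - W (u - c)) := by
  intro x c hcx
  obtain rfl : Zh = fun x y => 1 + ∫ z in y..x, ω z * F (z, y) := funext₂ hZh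
  have hωF : LocBdd fun p : ℝ × ℝ => ω p.1 * F p := (hωbdd.comp continuous_fst).mul hFbdd
  have hωFm : Measurable fun p : ℝ × ℝ => ω p.1 * F p := by fun_prop
  have hZ : LocBdd fun u => (1 + ∫ z in u..x, ω z * F (z, u)) * ω u :=
    ((hωF.intervalIntegral_left x).const_add 1).mul hωbdd
  have hZm : Measurable fun u => (1 + ∫ z in u..x, ω z * F (z, u)) * ω u :=
    ((measurable_intervalIntegral_left hωFm x).const_add 1).mul hωmeas
  have hdiff : ∀ u, Wq (u - c) - W (u - c) = q * ∫ y in c..u, W (u - y) * Wq (y - c) := by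
    intro u
    have h := intervalIntegral.integral_comp_sub_right (a := c) (b := u)
      (fun z => W (u - c - z) * Wq z) c
    simp only [sub_sub_sub_cancel_right, sub_self] at h
    rw [hWqeq (u - c), add_sub_cancel_left, h]
  have hswap := intervalIntegral_integral_triangle_swap
    (f := fun p : ℝ × ℝ => (1 + ∫ z in p.1..x, ω z * F (z, p.1)) * ω p.1 * W (p.1 - p.2)
      * Wq (p.2 - c))
    (((hZm.comp measurable_fst).mul (hWmeas.comp (by fun_prop))).mul
      (hWqmeas.comp (by fun_prop)))
    (((hZ.comp continuous_fst).mul (hWbdd.comp (by fun_prop))).mul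
      (hWqbdd.comp (by fun_prop))) hcx
  simp only [hdiff, add_sub_cancel_left]
  calc q * ∫ y in c..x, (∫ z in y..x, ω z * F (z, y)) * Wq (y - c)
      = q * ∫ y in c..x, ∫ u in y..x,
          (1 + ∫ z in u..x, ω z * F (z, u)) * ω u * W (u - y) * Wq (y - c) := by
        congr 1
        refine intervalIntegral.integral_congr fun y hy => ?_
        rw [uIcc_of_le hcx] at hy
        simp only [intervalIntegral.integral_mul_const]
        rw [integral_one_add_mul_kernel hWmeas hWbdd hωmeas hωbdd hFmeas hFbdd hFB hy.2]
    _ = _ := by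
        rw [← hswap, ← intervalIntegral.integral_const_mul]
        refine intervalIntegral.integral_congr fun u _ => ?_
        simp only [mul_assoc, intervalIntegral.integral_const_mul]
        ring
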